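/- arXiv:1905.13078 — 3 statements merged into one kernel-verified Lean document; each statement's English description precedes it below -/
import Mathlib

section
/- Let α > 0 and let φ_α = (α/2)(e¹²⁷ + e³⁴⁷ + e⁵⁶⁷) + e¹³⁵ − e¹⁴⁶ − e²³⁶ − e²⁴⁵ on ℝ⁷. Then for all u, v ∈ ℝ⁷ one has (1/6) ι_uφ_α ∧ ι_vφ_α ∧ φ_α = g_{φ_α}(u,v) · (α/2) e¹²³⁴⁵⁶⁷, where g_{φ_α} = Σ_{i=1}^{6} (e^i)² + (α²/4)(e⁷)². In particular g_{φ_α} is positive definite, so φ_α defines a G₂-structure with induced metric g_{φ_α} and volume form dV_{φ_α} = (α/2) e¹²³⁴⁵⁶⁷. -/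
/-!
Common framework: unbundled exterior forms on ℝ⁷, wedge product, interior product,
Chevalley–Eilenberg differential of a Lie bracket, induced inner products on forms,
derived series, and the Lie algebras / G₂-structures from the paper
"Laplacian flow solitons on non-solvable Lie groups" (Fino–Raffero).
-/

open scoped BigOperators

namespace G2Solitons

/-- The underlying vector space ℝ⁷. -/
abbrev V7 : Type := Fin 7 → ℝ

/-- Unbundled `k`-forms: real-valued functions of `k` vectors of ℝ⁷. -/
abbrev Form (k : ℕ) : Type := (Fin k → V7) → ℝ

/-- Standard basis of ℝ⁷. -/
def stdB (i : Fin 7) : V7 := fun j => if j = i then 1 else 0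

/-- The basic `k`-form `e^{i₁} ∧ ⋯ ∧ e^{i_k}` (determinant convention, 0-indexed). -/
def eB {k : ℕ} (idx : Fin k → Fin 7) : Form k :=
  fun v => Matrix.det (Matrix.of fun a b : Fin k => v a (idx b))

/-- Wedge product of a `p`-form and a `q`-form (convention
`(α∧β)(v) = (p!q!)⁻¹ ∑_σ sgn σ · α(v∘σ|_{first p}) β(v∘σ|_{last q})`). -/
noncomputable def wedge {p q : ℕ} (α : Form p) (β : Form q) : Form (p + q) := fun v =>
  ((p.factorial * q.factorial : ℕ) : ℝ)⁻¹ *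
    ∑ σ : Equiv.Perm (Fin (p + q)),
      ((Equiv.Perm.sign σ : ℤ) : ℝ) *
        (α (fun i => v (σ (Fin.castAdd q i))) * β (fun j => v (σ (Fin.natAdd p j))))

/-- Interior product of a vector with a `(k+1)`-form. -/
def iprod {k : ℕ} (u : V7) (α : Form (k + 1)) : Form k := fun v => α (Fin.cons u v)

/-- Chevalley–Eilenberg differential of a `(k+1)`-form with respect to a bracket:
`(dα)(x₀,…,x_{k+1}) = ∑_{i<j} (-1)^{i+j} α([xᵢ,xⱼ], x₀,…,x̂ᵢ,…,x̂ⱼ,…,x_{k+1})`. -/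
def dCE {k : ℕ} (br : V7 → V7 → V7) (α : Form (k + 1)) : Form (k + 2) := fun v =>
  ∑ i : Fin (k + 2), ∑ j : Fin (k + 2),
    if (i : ℕ) < (j : ℕ) then
      (-1 : ℝ) ^ ((i : ℕ) + (j : ℕ)) *
        α (Fin.cons (br (v i) (v j)) fun l : Fin k =>
            if (l : ℕ) < (i : ℕ) then v ⟨(l : ℕ), by omega⟩
            else if (l : ℕ) + 1 < (j : ℕ) then v ⟨(l : ℕ) + 1, by omega⟩
            else v ⟨(l : ℕ) + 2, by omega⟩)
    else 0

/-- Inner product on `k`-forms induced by the diagonal metric `g = ∑ᵢ c i (e^i)²`,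
determined by declaring `{(c i₁ ⋯ c i_k)^{-1/2} e^{i₁⋯i_k} : i₁ < ⋯ < i_k}` orthonormal. -/
noncomputable def formInner (c : Fin 7 → ℝ) {k : ℕ} (α β : Form k) : ℝ :=
  ((k.factorial : ℕ) : ℝ)⁻¹ *
    ∑ f : Fin k → Fin 7,
      (∏ i, c (f i))⁻¹ * (α (fun i => stdB (f i)) * β (fun i => stdB (f i)))

/-- Natural action of an endomorphism `D` on a `k`-form:
`(D.α)(v₁,…,v_k) = ∑ᵢ α(v₁,…,D vᵢ,…,v_k)`. -/
def actD {k : ℕ} (D : V7 → V7) (α : Form k) : Form k := fun v =>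
  ∑ i : Fin k, α (Function.update v i (D (v i)))

/-- The Jacobi identity for a bilinear bracket. -/
def Jacobi (br : V7 → V7 → V7) : Prop :=
  ∀ x y z : V7, br (br x y) z + br (br y z) x + br (br z x) y = 0

/-- Unimodularity: `tr (ad x) = 0` for all `x`. -/
def Unimodular (br : V7 → V7 → V7) : Prop :=
  ∀ x : V7, ∑ i : Fin 7, br x (stdB i) i = 0

/-- Derivation property for a map `D`. -/
def IsDeriv (br : V7 → V7 → V7) (D : V7 → V7) : Prop :=
  ∀ x y : V7, D (br x y) = br (D x) y + br x (D y)

/-- Derived series of a bracket. -/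
def derSeries (br : V7 → V7 → V7) : ℕ → Submodule ℝ V7
  | 0 => ⊤
  | n + 1 => Submodule.span ℝ
      {z | ∃ x ∈ derSeries br n, ∃ y ∈ derSeries br n, z = br x y}

/-- Solvability: the derived series terminates at zero. -/
def Solvable (br : V7 → V7 → V7) : Prop := ∃ n, derSeries br n = ⊥

/-- Real cube root (the real root, also for negative arguments). -/
noncomputable def cbrt (x : ℝ) : ℝ :=
  if x < 0 then -((-x) ^ ((1 : ℝ) / 3)) else x ^ ((1 : ℝ) / 3)

/-- The standard volume form `e^{1234567}`. -/
def vol7 : Form 7 := eB ![0, 1, 2, 3, 4, 5, 6]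

end G2Solitons

namespace G2Solitons

noncomputable section

/-- The bracket of the Lie algebra `𝔨_α` with structure equations
`(-α e¹⁷, -2 e³⁵, -e²⁵ - e⁵⁷, (α/2) e⁴⁷ - e⁶⁷, e²³ + e³⁷, e⁴⁷ + (α/2) e⁶⁷, 0)`,
via the convention `dβ(x,y) = -β([x,y])`. -/
def brK (α : ℝ) : V7 → V7 → V7 := fun x y =>
  ![α * (x 0 * y 6 - x 6 * y 0),
    2 * (x 2 * y 4 - x 4 * y 2),
    (x 1 * y 4 - x 4 * y 1) + (x 4 * y 6 - x 6 * y 4),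
    -(α / 2) * (x 3 * y 6 - x 6 * y 3) + (x 5 * y 6 - x 6 * y 5),
    -(x 1 * y 2 - x 2 * y 1) - (x 2 * y 6 - x 6 * y 2),
    -(x 3 * y 6 - x 6 * y 3) - α / 2 * (x 5 * y 6 - x 6 * y 5),
    0]

/-- `φ_α = (α/2)(e¹²⁷ + e³⁴⁷ + e⁵⁶⁷) + e¹³⁵ - e¹⁴⁶ - e²³⁶ - e²⁴⁵`. -/
def phiK (α : ℝ) : Form 3 := fun v =>
  α / 2 * (eB ![0, 1, 6] v + eB ![2, 3, 6] v + eB ![4, 5, 6] v)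
    + eB ![0, 2, 4] v - eB ![0, 3, 5] v - eB ![1, 2, 5] v - eB ![1, 3, 4] v

/-- Diagonal coefficients of the metric `g_{φ_α} = ∑_{i=1}^{6} (e^i)² + (α²/4)(e⁷)²`. -/
def cK (α : ℝ) : Fin 7 → ℝ := ![1, 1, 1, 1, 1, 1, α ^ 2 / 4]

/-- The metric `g_{φ_α}` as a bilinear form. -/
def gK (α : ℝ) (u v : V7) : ℝ := ∑ i : Fin 7, cK α i * u i * v i

/-- The volume form `dV_{φ_α} = (α/2) e¹²³⁴⁵⁶⁷`. -/
def dVK (α : ℝ) : Form 7 := fun v => α / 2 * vol7 v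

/-- `τ_α = 4 e¹² - 2 e³⁴ - 2 e⁵⁶`. -/
def tauK : Form 2 := fun v =>
  4 * eB ![0, 1] v - 2 * eB ![2, 3] v - 2 * eB ![4, 5] v

/-- `D = diag(-2, 0, 0, 4, 0, 4, 0)`. -/
def DK : V7 → V7 := fun x i => (![-2, 0, 0, 4, 0, 4, 0] : Fin 7 → ℝ) i * x i

end

end G2Solitons

namespace G2Solitons

lemma wedge_sum_smul {p q : ℕ} {ι κ : Type*} [Fintype ι] [Fintype κ]
    (a : ι → ℝ) (f : ι → Form p) (b : κ → ℝ) (g : κ → Form q) :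
    wedge (∑ i, a i • f i) (∑ j, b j • g j) =
      ∑ x : ι × κ, (a x.1 * b x.2) • wedge (f x.1) (g x.2) := by
  ext v
  simp only [wedge, Finset.sum_apply, Pi.smul_apply, smul_eq_mul, Fintype.sum_prod_type,
    Finset.sum_mul_sum]
  simp only [Finset.mul_sum]
  rw [Finset.sum_comm]
  refine Finset.sum_congr rfl fun i _ => ?_
  rw [Finset.sum_comm]
  refine Finset.sum_congr rfl fun j _ => Finset.sum_congr rfl fun σ _ => ?_
  ring

/-- Laplace expansion along a block decomposition: basic forms wedge by concatenation. -/
lemma wedge_eB {p q : ℕ} (I : Fin p → Fin 7) (J : Fin q → Fin 7) :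
    wedge (eB I) (eB J) = eB (Fin.append I J) := by
  ext v
  have expand (σ : Equiv.Perm (Fin (p + q))) :
      ((Equiv.Perm.sign σ : ℤ) : ℝ) *
        (eB I (fun i => v (σ (Fin.castAdd q i))) * eB J (fun j => v (σ (Fin.natAdd p j)))) =
      ∑ τ : Equiv.Perm (Fin p), ∑ ρ : Equiv.Perm (Fin q),
        ((Equiv.Perm.sign (σ * finSumFinEquiv.permCongr (Equiv.Perm.sumCongr τ ρ)) : ℤ) : ℝ) *
          ∏ b, v ((σ * finSumFinEquiv.permCongr (Equiv.Perm.sumCongr τ ρ)) b)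
            (Fin.append I J b) := by
    simp only [eB, Matrix.det_apply', Matrix.of_apply, Finset.sum_mul_sum]
    simp only [Finset.mul_sum]
    refine Finset.sum_congr rfl fun τ _ => Finset.sum_congr rfl fun ρ _ => ?_
    simp only [Fin.prod_univ_add, Equiv.Perm.sign_mul, Equiv.Perm.sign_permCongr,
      Equiv.Perm.sign_sumCongr, Equiv.Perm.mul_apply, Equiv.permCongr_apply,
      finSumFinEquiv_symm_apply_castAdd, finSumFinEquiv_symm_apply_natAdd,
      Equiv.Perm.sumCongr_apply, Sum.map_inl, Sum.map_inr, finSumFinEquiv_apply_left,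
      finSumFinEquiv_apply_right, Fin.append_left, Fin.append_right]
    push_cast
    ring
  have reindex (π : Equiv.Perm (Fin (p + q))) :
      ∑ σ : Equiv.Perm (Fin (p + q)), ((Equiv.Perm.sign (σ * π) : ℤ) : ℝ) *
        ∏ b, v ((σ * π) b) (Fin.append I J b) = eB (Fin.append I J) v := by
    rw [eB, Matrix.det_apply']
    exact Equiv.sum_comp (Equiv.mulRight π) fun σ : Equiv.Perm (Fin (p + q)) =>
      ((Equiv.Perm.sign σ : ℤ) : ℝ) * ∏ b, v (σ b) (Fin.append I J b)
  rw [wedge, Finset.sum_congr rfl fun σ _ => expand σ, Finset.sum_comm]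
  simp_rw [Finset.sum_comm (s := (Finset.univ : Finset (Equiv.Perm (Fin (p + q))))), reindex]
  have hp : ((p.factorial : ℕ) : ℝ) ≠ 0 := by positivity
  have hq : ((q.factorial : ℕ) : ℝ) ≠ 0 := by positivity
  simp only [Finset.sum_const, Finset.card_univ, Fintype.card_perm, Fintype.card_fin,
    nsmul_eq_mul, Nat.cast_mul]
  field_simp

/-- The Levi-Civita symbol. -/
def levi (idx : Fin 7 → Fin 7) : ℤ :=
  if Function.Injective idx then
    ∏ j, ∏ i ∈ Finset.Iio j, if idx i < idx j then 1 else -1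
  else 0

lemma eB_eq_levi_mul_vol7 (idx : Fin 7 → Fin 7) (w : Fin 7 → V7) :
    eB idx w = (levi idx : ℝ) * vol7 w := by
  have hvol : vol7 w = Matrix.det (Matrix.of w) := by
    rw [vol7, eB]
    congr 1
    ext a b
    fin_cases b <;> rfl
  rw [hvol]
  by_cases h : Function.Injective idx
  · let σ : Equiv.Perm (Fin 7) := Equiv.ofBijective idx (Finite.injective_iff_bijective.mp h)
    have hs : levi idx = (Equiv.Perm.sign σ : ℤ) := by
      rw [levi, if_pos h, Equiv.Perm.sign_eq_prod_prod_Iio]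
      push_cast
      refine Finset.prod_congr rfl fun j _ => Finset.prod_congr rfl fun i _ => ?_
      change _ = ((if idx i < idx j then 1 else -1 : ℤˣ) : ℤ)
      split_ifs <;> rfl
    rw [hs, ← Matrix.det_permute']
    rfl
  · rw [levi, if_neg h, Int.cast_zero, zero_mul]
    obtain ⟨a, b, hab, hne⟩ : ∃ a b, idx a = idx b ∧ a ≠ b := by
      simpa [Function.Injective] using h
    exact Matrix.det_zero_of_column_eq hne fun k => by simp [hab]

/-- The seven oriented lines of the Fano plane appearing in `phiK`. -/
def line : Fin 7 → Fin 3 → Fin 7 :=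
  ![![0, 1, 6], ![2, 3, 6], ![4, 5, 6], ![0, 2, 4], ![0, 5, 3], ![1, 5, 2], ![1, 4, 3]]

/-- The coefficient in `phiK` of the basic form of each line. -/
noncomputable def lineCoeff (α : ℝ) : Fin 7 → ℝ := ![α / 2, α / 2, α / 2, 1, 1, 1, 1]

lemma phiK_eq_sum_line (α : ℝ) : phiK α = ∑ r, lineCoeff α r • eB (line r) := by
  ext v
  simp [phiK, eB, Fin.sum_univ_succ, lineCoeff, line, Matrix.det_fin_three]
  ring

/-- The line `x.1` with its point number `x.2` removed, in cyclic order. -/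
def removePoint (x : Fin 7 × Fin 3) : Fin 2 → Fin 7 :=
  ![line x.1 (x.2 + 1), line x.1 (x.2 + 2)]

lemma iprod_eB (u : V7) (I : Fin 3 → Fin 7) :
    iprod u (eB I) = ∑ m, u (I m) • eB ![I (m + 1), I (m + 2)] := by
  ext v
  simp [iprod, eB, Fin.sum_univ_three, Matrix.det_fin_three, Matrix.det_fin_two]
  have hcons : (Fin.cons u v : Fin 3 → V7) 2 = v 1 := rfl
  simp only [hcons]
  ring

lemma iprod_phiK (α : ℝ) (u : V7) :
    iprod u (phiK α) = ∑ x : Fin 7 × Fin 3,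
      (lineCoeff α x.1 * u (line x.1 x.2)) • eB (removePoint x) := by
  have h : iprod u (phiK α) = ∑ r, lineCoeff α r • iprod u (eB (line r)) := by
    ext v
    simp [phiK_eq_sum_line, iprod]
  simp only [h, iprod_eB, Finset.smul_sum, smul_smul, Fintype.sum_prod_type, removePoint]

/-- The lines `x.1`, `y.1`, `t` are distinct and meet in the common point
`line x.1 x.2 = line y.1 y.2`. -/
def Concurrent (x y : Fin 7 × Fin 3) (t : Fin 7) : Prop :=
  line x.1 x.2 = line y.1 y.2 ∧ (∃ k, line t k = line x.1 x.2) ∧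
    x.1 ≠ y.1 ∧ x.1 ≠ t ∧ y.1 ≠ t

instance (x y : Fin 7 × Fin 3) (t : Fin 7) : Decidable (Concurrent x y t) :=
  inferInstanceAs (Decidable (_ ∧ _))

lemma levi_append_line : ∀ (x y : Fin 7 × Fin 3) (t : Fin 7),
    levi (Fin.append (Fin.append (removePoint x) (removePoint y)) (line t)) =
      if Concurrent x y t then 1 else 0 := by
  decide +kernel

lemma card_concurrent : ∀ i : Fin 7,
    (Finset.univ.filter fun z : ((Fin 7 × Fin 3) × (Fin 7 × Fin 3)) × Fin 7 =>
      Concurrent z.1.1 z.1.2 z.2 ∧ line z.1.1.1 z.1.1.2 = i).card = 6 := by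
  decide +kernel

/-- All three lines through the point `6` have index below `3`, and exactly one of the three
lines through any other point does. -/
lemma count_of_concurrent : ∀ (x y : Fin 7 × Fin 3) (t : Fin 7), Concurrent x y t →
    (line x.1 x.2 = 6 ∧ x.1 < 3 ∧ y.1 < 3 ∧ t < 3) ∨
      (line x.1 x.2 ≠ 6 ∧ ((x.1 < 3 ∧ ¬ y.1 < 3 ∧ ¬ t < 3) ∨ (¬ x.1 < 3 ∧ y.1 < 3 ∧ ¬ t < 3) ∨
        (¬ x.1 < 3 ∧ ¬ y.1 < 3 ∧ t < 3))) := by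
  decide +kernel

lemma lineCoeff_mul_of_concurrent (α : ℝ) {x y : Fin 7 × Fin 3} {t : Fin 7}
    (h : Concurrent x y t) :
    lineCoeff α x.1 * lineCoeff α y.1 * lineCoeff α t = cK α (line x.1 x.2) * (α / 2) := by
  have hcoeff (r : Fin 7) : lineCoeff α r = if r < 3 then α / 2 else 1 := by
    fin_cases r <;> simp [lineCoeff]
  have hmetric (i : Fin 7) : cK α i = if i = 6 then (α / 2) ^ 2 else 1 := by
    fin_cases i <;> simp [cK]; ring
  have hcount := count_of_concurrent x y t h
  rw [hcoeff, hcoeff, hcoeff, hmetric]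
  rcases hcount with ⟨h6, hx, hy, ht⟩ | ⟨h6, ⟨hx, hy, ht⟩ | ⟨hx, hy, ht⟩ | ⟨hx, hy, ht⟩⟩ <;>
    simp only [h6, hx, hy, ht, if_true, if_false] <;> ring

lemma wedge_iprod_phiK (α : ℝ) (u v : V7) :
    wedge (wedge (iprod u (phiK α)) (iprod v (phiK α))) (phiK α) =
      fun w => 6 * (gK α u v * dVK α w) := by
  ext w
  rw [iprod_phiK, iprod_phiK, wedge_sum_smul, phiK_eq_sum_line, wedge_sum_smul]
  simp only [wedge_eB, Finset.sum_apply, Pi.smul_apply, smul_eq_mul]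
  have term (z : ((Fin 7 × Fin 3) × (Fin 7 × Fin 3)) × Fin 7) :
      lineCoeff α z.1.1.1 * u (line z.1.1.1 z.1.1.2) *
          (lineCoeff α z.1.2.1 * v (line z.1.2.1 z.1.2.2)) * lineCoeff α z.2 *
        eB (Fin.append (Fin.append (removePoint z.1.1) (removePoint z.1.2)) (line z.2)) w =
      ∑ i, if Concurrent z.1.1 z.1.2 z.2 ∧ line z.1.1.1 z.1.1.2 = i then
        cK α i * u i * v i * dVK α w else 0 := by
    refine (congrArg _ (eB_eq_levi_mul_vol7 _ w)).trans ?_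
    rw [levi_append_line]
    by_cases h : Concurrent z.1.1 z.1.2 z.2
    · simp only [h, true_and, if_true, Finset.sum_ite_eq, Finset.mem_univ, Int.cast_one, one_mul,
        dVK]
      rw [← show line z.1.1.1 z.1.1.2 = line z.1.2.1 z.1.2.2 from h.1]
      linear_combination (u (line z.1.1.1 z.1.1.2) * v (line z.1.1.1 z.1.1.2) * vol7 w) *
        lineCoeff_mul_of_concurrent α h
    · simp [h]
  rw [Finset.sum_congr rfl fun z _ => term z, Finset.sum_comm]
  simp_rw [← Finset.sum_filter, Finset.sum_const, card_concurrent]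
  simp only [gK, Finset.sum_mul, Finset.mul_sum, nsmul_eq_mul, Nat.cast_ofNat]

lemma gK_self_pos {α : ℝ} (hα : 0 < α) {u : V7} (hu : u ≠ 0) : 0 < gK α u u := by
  have hc (i : Fin 7) : 0 < cK α i := by
    have : 0 < α ^ 2 / 4 := by positivity
    fin_cases i <;> simp [cK, hα]
  obtain ⟨i, hi⟩ := Function.ne_iff.mp hu
  refine Finset.sum_pos' (fun j _ => ?_) ⟨i, Finset.mem_univ i, ?_⟩
  · rw [mul_assoc]
    exact mul_nonneg (hc j).le (mul_self_nonneg _)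
  · rw [mul_assoc]
    exact mul_pos (hc i) (mul_self_pos.mpr hi)

/-- `(1/6) ι_uφ_α ∧ ι_vφ_α ∧ φ_α = g_{φ_α}(u,v) dV_{φ_α}` and
`g_{φ_α}` is positive definite, so `φ_α` defines a G₂-structure. -/
theorem bphi_K (α : ℝ) (hα : 0 < α) :
    (∀ u v : V7, ∀ w : Fin 7 → V7,
      (1 / 6 : ℝ) * wedge (wedge (iprod u (phiK α)) (iprod v (phiK α))) (phiK α) w
        = gK α u v * dVK α w) ∧
    ∀ u : V7, u ≠ 0 → 0 < gK α u u := by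
  refine ⟨fun u v w => ?_, fun u hu => gK_self_pos hα hu⟩
  rw [wedge_iprod_phiK]
  ring

end G2Solitons
end

section
/- The skew-symmetric bilinear bracket on ℝ⁷ determined (via the convention dα(x,y) = −α([x,y]) for 1-forms α) by the structure equations de¹ = 0, de² = 0, de³ = −e³⁷, de⁴ = e⁴⁷, de⁵ = 2 e¹⁴ + e⁵⁷, de⁶ = −2 e²⁴ + e⁶⁷, de⁷ = 0 satisfies the Jacobi identity, hence defines a Lie algebra 𝔥; moreover 𝔥 is solvable and is not unimodular (i.e., there exists x ∈ 𝔥 with tr(ad x) ≠ 0). -/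
/-!
Common framework: unbundled exterior forms on ℝ⁷, wedge product, interior product,
Chevalley–Eilenberg differential of a Lie bracket, induced inner products on forms,
derived series, and the Lie algebras / G₂-structures from the paper
"Laplacian flow solitons on non-solvable Lie groups" (Fino–Raffero).
-/

open scoped BigOperators

namespace G2Solitons

noncomputable section

/-- The bracket of the Lie algebra `𝔥` with structure equations
`(0, 0, -e³⁷, e⁴⁷, 2 e¹⁴ + e⁵⁷, -2 e²⁴ + e⁶⁷, 0)`,
via the convention `dα(x,y) = -α([x,y])`. -/
def brH : V7 → V7 → V7 := fun x y =>
  ![0,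
    0,
    x 2 * y 6 - x 6 * y 2,
    -(x 3 * y 6 - x 6 * y 3),
    -2 * (x 0 * y 3 - x 3 * y 0) - (x 4 * y 6 - x 6 * y 4),
    2 * (x 1 * y 3 - x 3 * y 1) - (x 5 * y 6 - x 6 * y 5),
    0]

/-- `φ = e¹²⁷ + e³⁴⁷ + e⁵⁶⁷ + e¹³⁵ - e¹⁴⁶ - e²³⁶ - e²⁴⁵`. -/
def phiH : Form 3 := fun v =>
  eB ![0, 1, 6] v + eB ![2, 3, 6] v + eB ![4, 5, 6] v
    + eB ![0, 2, 4] v - eB ![0, 3, 5] v - eB ![1, 2, 5] v - eB ![1, 3, 4] v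

/-- The standard Euclidean metric `g_φ = ∑_{i=1}^{7} (e^i)²`. -/
def gH (u v : V7) : ℝ := ∑ i : Fin 7, u i * v i

/-- `τ = 2 e¹² + 2 e³⁴ - 4 e⁵⁶`. -/
def tauH : Form 2 := fun v =>
  2 * eB ![0, 1] v + 2 * eB ![2, 3] v - 4 * eB ![4, 5] v

/-- `D = diag(0, 0, -4, 4, 4, 4, 0)`. -/
def DH : V7 → V7 := fun x i => (![0, 0, -4, 4, 4, 4, 0] : Fin 7 → ℝ) i * x i

end

end G2Solitons

namespace G2Solitons

theorem jacobi_brH : Jacobi brH := by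
  intro x y z
  funext i
  fin_cases i <;> simp [brH] <;> ring

/-- Elements of the derived algebra of `𝔥` are annihilated by `e¹`, `e²` and `e⁷`. -/
theorem apply_eq_zero_of_mem_derSeries_one_brH {x : V7} (hx : x ∈ derSeries brH 1) :
    x 0 = 0 ∧ x 1 = 0 ∧ x 6 = 0 := by
  induction hx using Submodule.span_induction with
  | mem x h =>
    obtain ⟨u, -, v, -, rfl⟩ := h
    simp [brH]
  | zero => simp
  | add x y _ _ hx hy => simp [hx, hy]
  | smul a x _ hx => simp [hx]

theorem derSeries_two_brH : derSeries brH 2 = ⊥ := by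
  refine Submodule.span_eq_bot.2 ?_
  rintro _ ⟨x, hx, y, hy, rfl⟩
  obtain ⟨hx0, hx1, hx6⟩ := apply_eq_zero_of_mem_derSeries_one_brH hx
  obtain ⟨hy0, hy1, hy6⟩ := apply_eq_zero_of_mem_derSeries_one_brH hy
  funext i
  fin_cases i <;> simp [brH, hx0, hx1, hx6, hy0, hy1, hy6]

theorem not_unimodular_brH : ¬ Unimodular brH := by
  intro h
  have := h (stdB 6)
  simp [Fin.sum_univ_seven, brH] at this
  norm_num [stdB, Fin.ext_iff] at this

/-- the structure equations of `𝔥` satisfy the Jacobi identity,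
and `𝔥` is solvable and not unimodular. -/
theorem jacobi_solvable_not_unimodular_brH :
    Jacobi brH ∧ Solvable brH ∧ ¬ Unimodular brH :=
  ⟨jacobi_brH, ⟨2, derSeries_two_brH⟩, not_unimodular_brH⟩

end G2Solitons
end

section
/- Let 𝔥 be the Lie algebra on ℝ⁷ with structure equations de¹ = 0, de² = 0, de³ = −e³⁷, de⁴ = e⁴⁷, de⁵ = 2 e¹⁴ + e⁵⁷, de⁶ = −2 e²⁴ + e⁶⁷, de⁷ = 0, let φ = e¹²⁷ + e³⁴⁷ + e⁵⁶⁷ + e¹³⁵ − e¹⁴⁶ − e²³⁶ − e²⁴⁵ with induced metric g_φ = Σ_{i=1}^{7} (e^i)² and volume form dV_φ = e¹²³⁴⁵⁶⁷, and let ψ be the unique 4-form on ℝ⁷ such that α ∧ ψ = ⟨α, φ⟩_{g_φ} dV_φ for every 3-form α (i.e., ψ = *_φφ). Then dψ = τ ∧ φ where τ = 2 e¹² + 2 e³⁴ − 4 e⁵⁶ (so τ is the intrinsic torsion form of φ), and moreover dτ = −8(e¹⁴⁶ + e²⁴⁵ − e⁵⁶⁷). -/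
/-!
Common framework: unbundled exterior forms on ℝ⁷, wedge product, interior product,
Chevalley–Eilenberg differential of a Lie bracket, induced inner products on forms,
derived series, and the Lie algebras / G₂-structures from the paper
"Laplacian flow solitons on non-solvable Lie groups" (Fino–Raffero).
-/

open scoped BigOperators

namespace G2Solitons

section Wedge

variable {p q : ℕ}

/-- The permutation of `Fin (p + q)` acting by `π` on the first block and by `ρ` on the second. -/
def blockPerm (π : Equiv.Perm (Fin p)) (ρ : Equiv.Perm (Fin q)) : Equiv.Perm (Fin (p + q)) :=
  finSumFinEquiv.permCongr (Equiv.Perm.sumCongr π ρ)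

@[simp]
lemma blockPerm_castAdd (π : Equiv.Perm (Fin p)) (ρ : Equiv.Perm (Fin q)) (i : Fin p) :
    blockPerm π ρ (Fin.castAdd q i) = Fin.castAdd q (π i) := by
  simp [blockPerm, Equiv.permCongr_apply]

@[simp]
lemma blockPerm_natAdd (π : Equiv.Perm (Fin p)) (ρ : Equiv.Perm (Fin q)) (j : Fin q) :
    blockPerm π ρ (Fin.natAdd p j) = Fin.natAdd p (ρ j) := by
  simp [blockPerm, Equiv.permCongr_apply]

@[simp]
lemma sign_blockPerm (π : Equiv.Perm (Fin p)) (ρ : Equiv.Perm (Fin q)) :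
    Equiv.Perm.sign (blockPerm π ρ) = Equiv.Perm.sign π * Equiv.Perm.sign ρ := by
  simp [blockPerm]

lemma blockPerm_injective :
    Function.Injective fun x : Equiv.Perm (Fin p) × Equiv.Perm (Fin q) => blockPerm x.1 x.2 :=
  fun _ _ h => Equiv.Perm.sumCongrHom_injective (finSumFinEquiv.permCongr.injective h)

lemma exists_blockPerm_eq (σ : Equiv.Perm (Fin (p + q)))
    (h : ∀ i j, σ (Fin.castAdd q i) ≠ Fin.natAdd p j) : ∃ π ρ, blockPerm π ρ = σ := by
  obtain ⟨⟨π, ρ⟩, hx⟩ := Equiv.Perm.mem_sumCongrHom_range_of_perm_mapsTo_inl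
    (σ := finSumFinEquiv.symm.permCongr σ) (by
      rintro _ ⟨i, rfl⟩
      rcases hc : finSumFinEquiv.symm.permCongr σ (Sum.inl i) with a | b
      · exact ⟨a, rfl⟩
      · refine absurd ?_ (h i b)
        rw [Equiv.permCongr_apply, Equiv.symm_apply_eq] at hc
        simpa using hc)
  refine ⟨π, ρ, ?_⟩
  have : Equiv.Perm.sumCongr π ρ = finSumFinEquiv.symm.permCongr σ := hx
  rw [blockPerm, this]
  ext
  simp [Equiv.permCongr_apply]

/-- If `α` vanishes on every rearrangement of `v` that puts a vector of the second block into the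
first one, then only the identity shuffle contributes to `(α ∧ ψ)(v)`. -/
lemma wedge_eq_mul (α : AlternatingMap ℝ V7 ℝ (Fin p)) (ψ : AlternatingMap ℝ V7 ℝ (Fin q))
    (v : Fin (p + q) → V7)
    (h : ∀ σ : Equiv.Perm (Fin (p + q)), (∃ i j, σ (Fin.castAdd q i) = Fin.natAdd p j) →
      α (fun i => v (σ (Fin.castAdd q i))) = 0) :
    wedge α ψ v = α (fun i => v (Fin.castAdd q i)) * ψ (fun j => v (Fin.natAdd p j)) := by
  rw [wedge, ← Finset.sum_subset (Finset.subset_univ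
    (Finset.univ.image fun x : Equiv.Perm (Fin p) × Equiv.Perm (Fin q) => blockPerm x.1 x.2)),
    Finset.sum_image blockPerm_injective.injOn]
  · have hterm (x : Equiv.Perm (Fin p) × Equiv.Perm (Fin q)) :
        ((Equiv.Perm.sign (blockPerm x.1 x.2) : ℤ) : ℝ) *
          (α (fun i => v (blockPerm x.1 x.2 (Fin.castAdd q i))) *
            ψ (fun j => v (blockPerm x.1 x.2 (Fin.natAdd p j)))) =
        α (fun i => v (Fin.castAdd q i)) * ψ (fun j => v (Fin.natAdd p j)) := by
      have hα := α.map_perm (fun i => v (Fin.castAdd q i)) x.1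
      have hψ := ψ.map_perm (fun i => v (Fin.natAdd p i)) x.2
      simp only [Function.comp_def] at hα hψ
      simp only [blockPerm_castAdd, blockPerm_natAdd, sign_blockPerm, hα, hψ]
      rcases Int.units_eq_one_or (Equiv.Perm.sign x.1) with h1 | h1 <;>
        rcases Int.units_eq_one_or (Equiv.Perm.sign x.2) with h2 | h2 <;> simp [h1, h2]
    rw [Finset.sum_congr rfl fun x _ => hterm x, Finset.sum_const, Finset.card_univ,
      Fintype.card_prod, Fintype.card_perm, Fintype.card_perm, Fintype.card_fin, Fintype.card_fin,
      nsmul_eq_mul, inv_mul_cancel_left₀]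
    exact_mod_cast (Nat.mul_pos p.factorial_pos q.factorial_pos).ne'
  · intro σ _ hσ
    rw [h σ, zero_mul, mul_zero]
    by_contra! hc
    obtain ⟨π, ρ, rfl⟩ := exists_blockPerm_eq σ hc
    exact hσ (Finset.mem_image.2 ⟨(π, ρ), Finset.mem_univ _, rfl⟩)

lemma wedge_eB_eB (I : Fin p → Fin 7) (J : Fin q → Fin 7) :
    wedge (eB I) (eB J) = eB (Fin.append I J) := by
  funext v
  have hterm (σ : Equiv.Perm (Fin (p + q))) :
      ((Equiv.Perm.sign σ : ℤ) : ℝ) *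
        (eB I (fun i => v (σ (Fin.castAdd q i))) * eB J (fun j => v (σ (Fin.natAdd p j)))) =
      ∑ π : Equiv.Perm (Fin p), ∑ ρ : Equiv.Perm (Fin q),
        ((Equiv.Perm.sign (σ * blockPerm π ρ) : ℤ) : ℝ) *
          ∏ k, v ((σ * blockPerm π ρ) k) (Fin.append I J k) := by
    rw [eB, eB, Matrix.det_apply', Matrix.det_apply', Finset.sum_mul_sum, Finset.mul_sum]
    refine Finset.sum_congr rfl fun π _ => ?_
    rw [Finset.mul_sum]
    refine Finset.sum_congr rfl fun ρ _ => ?_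
    rw [Fin.prod_univ_add]
    simp only [Matrix.of_apply, Equiv.Perm.mul_apply, blockPerm_castAdd, blockPerm_natAdd,
      Fin.append_left, Fin.append_right, Equiv.Perm.sign_mul, sign_blockPerm]
    push_cast
    ring
  rw [wedge, Finset.sum_congr rfl fun σ _ => hterm σ, Finset.sum_comm]
  have hshift (π : Equiv.Perm (Fin p)) (ρ : Equiv.Perm (Fin q)) :
      ∑ σ : Equiv.Perm (Fin (p + q)), ((Equiv.Perm.sign (σ * blockPerm π ρ) : ℤ) : ℝ) *
        ∏ k, v ((σ * blockPerm π ρ) k) (Fin.append I J k) = eB (Fin.append I J) v := by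
    rw [eB, Matrix.det_apply']
    exact Equiv.sum_comp (Equiv.mulRight (blockPerm π ρ)) fun σ : Equiv.Perm (Fin (p + q)) =>
      ((Equiv.Perm.sign σ : ℤ) : ℝ) * ∏ k, v (σ k) (Fin.append I J k)
  rw [Finset.sum_congr rfl fun π _ => Finset.sum_comm]
  simp only [hshift, Finset.sum_const, Finset.card_univ, Fintype.card_perm, Fintype.card_fin,
    nsmul_eq_mul]
  have hp : (p.factorial : ℝ) ≠ 0 := mod_cast p.factorial_ne_zero
  have hq : (q.factorial : ℝ) ≠ 0 := mod_cast q.factorial_ne_zero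
  push_cast
  field_simp

end Wedge

section BasicForms

variable {k : ℕ}

/-- The basic form `eB I` as an alternating map. -/
def eBAlt (I : Fin k → Fin 7) : AlternatingMap ℝ V7 ℝ (Fin k) :=
  Matrix.detRowAlternating.compLinearMap (LinearMap.funLeft ℝ ℝ I)

@[simp]
lemma coe_eBAlt (I : Fin k → Fin 7) : ⇑(eBAlt I) = eB I := rfl

lemma eB_eq_zero_of_row {I : Fin k → Fin 7} {v : Fin k → V7} (a : Fin k)
    (h : ∀ b, v a (I b) = 0) : eB I v = 0 :=
  Matrix.det_eq_zero_of_row_eq_zero a h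

lemma stdB_eq_basisFun (i : Fin 7) : stdB i = Pi.basisFun ℝ (Fin 7) i := by
  ext j
  simp [stdB, Pi.single_apply]

/-- Basic forms with increasing indices are dual to the increasing families of basis vectors. -/
lemma eB_stdB {I J : Fin k → Fin 7} (hI : StrictMono I) (hJ : StrictMono J) :
    eB I (fun a => stdB (J a)) = if I = J then 1 else 0 := by
  split_ifs with h
  · subst h
    have : (Matrix.of fun a b : Fin k => stdB (I a) (I b)) = 1 := by
      ext a b
      simp [stdB, Matrix.one_apply, hI.injective.eq_iff, eq_comm]
    rw [eB, this, Matrix.det_one]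
  · by_contra hne
    have hsub : Set.range J ⊆ Set.range I := by
      rintro _ ⟨a, rfl⟩
      by_contra hc
      refine hne (eB_eq_zero_of_row a fun b => ?_)
      simpa [stdB] using fun hb => hc ⟨b, hb⟩
    have hcard : (Finset.univ.image J) = Finset.univ.image I := by
      refine Finset.eq_of_subset_of_card_le ?_ ?_
      · intro x hx
        simpa using hsub (by simpa using hx)
      · rw [Finset.card_image_of_injective _ hI.injective,
          Finset.card_image_of_injective _ hJ.injective]
    refine h ((StrictMono.range_inj hI hJ).1 ?_)
    simpa using congrArg (fun s : Finset (Fin 7) => (s : Set (Fin 7))) hcard.symm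

lemma formInner_one_eB (I : Fin k → Fin 7) (β : AlternatingMap ℝ V7 ℝ (Fin k)) :
    formInner (fun _ => 1) (eB I) β = β (fun a => stdB (I a)) := by
  have hterm (f : Fin k → Fin 7) : eB I (fun i => stdB (f i)) =
      ∑ π : Equiv.Perm (Fin k), ((Equiv.Perm.sign π : ℤ) : ℝ) *
        if f = fun i => I (π i) then 1 else 0 := by
    rw [eB, ← Matrix.det_transpose, Matrix.det_apply']
    refine Finset.sum_congr rfl fun π _ => ?_
    congr 1
    simp only [Matrix.transpose_apply, Matrix.of_apply, stdB, Finset.prod_boole, Finset.mem_univ,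
      true_implies, funext_iff, eq_comm]
  simp only [formInner, hterm, Finset.prod_const_one, inv_one, one_mul, Finset.sum_mul]
  rw [Finset.sum_comm]
  have hsum (π : Equiv.Perm (Fin k)) : ∑ f : Fin k → Fin 7, ((Equiv.Perm.sign π : ℤ) : ℝ) *
      (if f = fun i => I (π i) then 1 else 0) * β (fun i => stdB (f i)) =
      β (fun a => stdB (I a)) := by
    have hβ := β.map_perm (fun i => stdB (I i)) π
    simp only [Function.comp_def] at hβ
    simp only [mul_ite, mul_one, mul_zero, ite_mul, zero_mul, Finset.sum_ite_eq',
      Finset.mem_univ, if_true, hβ]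
    rcases Int.units_eq_one_or (Equiv.Perm.sign π) with h1 | h1 <;> simp [h1]
  rw [Finset.sum_congr rfl fun π _ => hsum π]
  simp only [Finset.sum_const, Finset.card_univ, Fintype.card_perm, Fintype.card_fin,
    nsmul_eq_mul]
  exact inv_mul_cancel_left₀ (mod_cast k.factorial_ne_zero) _

/-- Alternating forms agreeing on increasing families of basis vectors are equal. -/
lemma alternatingMap_ext_stdB {f g : AlternatingMap ℝ V7 ℝ (Fin k)}
    (h : ∀ J : Fin k → Fin 7, StrictMono J →
      f (fun a => stdB (J a)) = g (fun a => stdB (J a))) : f = g := by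
  refine Module.Basis.ext_alternating (Pi.basisFun ℝ (Fin 7)) fun J hJ => ?_
  simp only [← stdB_eq_basisFun]
  have hs : StrictMono (J ∘ Tuple.sort J) :=
    (Tuple.monotone_sort J).strictMono_of_injective (hJ.comp (Tuple.sort J).injective)
  have hf := f.map_perm (fun a => stdB (J a)) (Tuple.sort J)
  have hg := g.map_perm (fun a => stdB (J a)) (Tuple.sort J)
  have := h _ hs
  simp only [Function.comp_def] at hf hg this
  rw [hf, hg] at this
  exact smul_left_cancel _ this

lemma vol7_stdB (K : Equiv.Perm (Fin 7)) :
    vol7 (fun a => stdB (K a)) = ((Equiv.Perm.sign K : ℤ) : ℝ) := by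
  have hid : (![0, 1, 2, 3, 4, 5, 6] : Fin 7 → Fin 7) = id := by decide
  rw [vol7, hid, eB, ← Matrix.det_permutation]
  congr 1
  ext a b
  simp [stdB, Equiv.Perm.permMatrix, PEquiv.toMatrix_apply, eq_comm]

/-- Values on basis vectors of a form with the defining pairing property of the Hodge dual. -/
lemma hodge_apply_stdB {φ : AlternatingMap ℝ V7 ℝ (Fin 3)} {ψ : AlternatingMap ℝ V7 ℝ (Fin 4)}
    (hψ : ∀ α : AlternatingMap ℝ V7 ℝ (Fin 3), ∀ w : Fin 7 → V7,
      wedge (⇑α) (⇑ψ) w = formInner (fun _ => 1) (⇑α) φ * vol7 w)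
    (K : Equiv.Perm (Fin (3 + 4))) :
    ψ (fun j => stdB (K (Fin.natAdd 3 j))) =
      φ (fun i => stdB (K (Fin.castAdd 4 i))) * ((Equiv.Perm.sign K : ℤ) : ℝ) := by
  have h := hψ (eBAlt fun i => K (Fin.castAdd 4 i)) fun a => stdB (K a)
  rw [vol7_stdB, coe_eBAlt, formInner_one_eB, ← coe_eBAlt, wedge_eq_mul] at h
  · rw [← h]
    have hone : (Matrix.of fun a b : Fin 3 =>
        stdB (K (Fin.castAdd 4 a)) (K (Fin.castAdd 4 b))) = 1 := by
      ext a b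
      simp [stdB, Matrix.one_apply, (Fin.castAdd_injective 3 4).eq_iff, eq_comm]
    rw [coe_eBAlt, eB, hone, Matrix.det_one, one_mul]
  · rintro σ ⟨i, j, hij⟩
    rw [coe_eBAlt]
    refine eB_eq_zero_of_row i fun b => ?_
    rw [hij]
    have : Fin.castAdd 4 b ≠ Fin.natAdd 3 j := by
      simp only [ne_eq, Fin.ext_iff, Fin.val_castAdd, Fin.val_natAdd]; omega
    simpa [stdB] using this

end BasicForms

section HodgeDual

/-- The form `φ` as an alternating map. -/
noncomputable def phiAlt : AlternatingMap ℝ V7 ℝ (Fin 3) :=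
  eBAlt ![0, 1, 6] + eBAlt ![2, 3, 6] + eBAlt ![4, 5, 6]
    + eBAlt ![0, 2, 4] - eBAlt ![0, 3, 5] - eBAlt ![1, 2, 5] - eBAlt ![1, 3, 4]

lemma coe_phiAlt : ⇑phiAlt = phiH := rfl

/-- The Hodge dual of `φ`, namely
`e³⁴⁵⁶ + e¹²⁵⁶ + e¹²³⁴ - e²⁴⁶⁷ + e²³⁵⁷ + e¹⁴⁵⁷ + e¹³⁶⁷`. -/
noncomputable def psiAlt : AlternatingMap ℝ V7 ℝ (Fin 4) :=
  eBAlt ![2, 3, 4, 5] + eBAlt ![0, 1, 4, 5] + eBAlt ![0, 1, 2, 3]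
    - eBAlt ![1, 3, 5, 6] + eBAlt ![1, 2, 4, 6] + eBAlt ![0, 3, 4, 6] + eBAlt ![0, 2, 5, 6]

/-- The integer value of `eB P` on the basis vectors with indices `I`. -/
def eBInt (P I : Fin 3 → Fin 7) : ℤ :=
  let δ : Fin 3 → Fin 3 → ℤ := fun a b => if P b = I a then 1 else 0
  δ 0 0 * δ 1 1 * δ 2 2 - δ 0 0 * δ 1 2 * δ 2 1 - δ 0 1 * δ 1 0 * δ 2 2
    + δ 0 1 * δ 1 2 * δ 2 0 + δ 0 2 * δ 1 0 * δ 2 1 - δ 0 2 * δ 1 1 * δ 2 0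

lemma eB_stdB_eq_eBInt (P I : Fin 3 → Fin 7) : eB P (fun a => stdB (I a)) = (eBInt P I : ℝ) := by
  simp only [eB, Matrix.det_fin_three, Matrix.of_apply, stdB, eBInt]
  push_cast
  rfl

/-- A permutation taking `3, 4, 5, 6` to `a < b < c < d`. -/
def shuffle (a b c d : Fin 7) : Equiv.Perm (Fin 7) :=
  Equiv.swap 6 d * Equiv.swap 5 c * Equiv.swap 4 b * Equiv.swap 3 a

lemma shuffle_natAdd : ∀ a b c d : Fin 7, a < b → b < c → c < d →
    ∀ j : Fin 4, shuffle a b c d (Fin.natAdd 3 j) = ![a, b, c, d] j := by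
  decide +kernel

lemma sign_shuffle (a b c d : Fin 7) : ((Equiv.Perm.sign (shuffle a b c d) : ℤˣ) : ℤ) =
    (if 6 = d then 1 else -1) * (if 5 = c then 1 else -1) * (if 4 = b then 1 else -1)
      * (if 3 = a then 1 else -1) := by
  simp only [shuffle, Equiv.Perm.sign_mul, Equiv.Perm.sign_swap', Units.val_mul, apply_ite Units.val,
    Units.val_one, Units.val_neg]

lemma psi_eq_phi_shuffle : ∀ a b c d : Fin 7, a < b → b < c → c < d →
    let I : Fin 3 → Fin 7 := fun i => shuffle a b c d (Fin.castAdd 4 i)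
    let δ : (Fin 4 → Fin 7) → ℤ := fun P => if P = ![a, b, c, d] then 1 else 0
    (eBInt ![0, 1, 6] I + eBInt ![2, 3, 6] I + eBInt ![4, 5, 6] I + eBInt ![0, 2, 4] I
      - eBInt ![0, 3, 5] I - eBInt ![1, 2, 5] I - eBInt ![1, 3, 4] I) *
      ((if 6 = d then 1 else -1) * (if 5 = c then 1 else -1) * (if 4 = b then 1 else -1)
        * (if 3 = a then 1 else -1)) =
    δ ![2, 3, 4, 5] + δ ![0, 1, 4, 5] + δ ![0, 1, 2, 3]
      - δ ![1, 3, 5, 6] + δ ![1, 2, 4, 6] + δ ![0, 3, 4, 6] + δ ![0, 2, 5, 6] := by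
  decide +kernel

lemma eq_psiAlt {ψ : AlternatingMap ℝ V7 ℝ (Fin 4)}
    (hψ : ∀ α : AlternatingMap ℝ V7 ℝ (Fin 3), ∀ w : Fin 7 → V7,
      wedge (⇑α) (⇑ψ) w = formInner (fun _ => 1) (⇑α) phiH * vol7 w) :
    ψ = psiAlt := by
  refine alternatingMap_ext_stdB fun J hJ => ?_
  have h01 : J 0 < J 1 := hJ (by decide)
  have h12 : J 1 < J 2 := hJ (by decide)
  have h23 : J 2 < J 3 := hJ (by decide)
  have hJ' : ![J 0, J 1, J 2, J 3] = J := by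
    ext i; fin_cases i <;> rfl
  have h := hodge_apply_stdB (φ := phiAlt) hψ (shuffle (J 0) (J 1) (J 2) (J 3))
  have hval := psi_eq_phi_shuffle _ _ _ _ h01 h12 h23
  rw [← sign_shuffle] at hval
  simp only [shuffle_natAdd _ _ _ _ h01 h12 h23] at h
  simp only [hJ'] at h hval
  rw [h]
  simp only [psiAlt, phiAlt, AlternatingMap.add_apply, AlternatingMap.sub_apply, coe_eBAlt]
  rw [eB_stdB (by decide) hJ, eB_stdB (by decide) hJ, eB_stdB (by decide) hJ,
    eB_stdB (by decide) hJ, eB_stdB (by decide) hJ, eB_stdB (by decide) hJ,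
    eB_stdB (by decide) hJ]
  simp only [eB_stdB_eq_eBInt]
  exact_mod_cast hval

end HodgeDual

section Linearity

variable {p q k : ℕ}

lemma wedge_add_left (α α' : Form p) (β : Form q) :
    wedge (α + α') β = wedge α β + wedge α' β := by
  funext v
  simp only [wedge, Pi.add_apply, add_mul, mul_add, Finset.sum_add_distrib]

lemma wedge_smul_left (c : ℝ) (α : Form p) (β : Form q) : wedge (c • α) β = c • wedge α β := by
  funext v
  simp only [wedge, Pi.smul_apply, smul_eq_mul, Finset.mul_sum]
  exact Finset.sum_congr rfl fun _ _ => by ring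

lemma wedge_add_right (α : Form p) (β β' : Form q) :
    wedge α (β + β') = wedge α β + wedge α β' := by
  funext v
  simp only [wedge, Pi.add_apply, mul_add, Finset.sum_add_distrib]

lemma wedge_smul_right (c : ℝ) (α : Form p) (β : Form q) : wedge α (c • β) = c • wedge α β := by
  funext v
  simp only [wedge, Pi.smul_apply, smul_eq_mul, Finset.mul_sum]
  exact Finset.sum_congr rfl fun _ _ => by ring

lemma dCE_add (br : V7 → V7 → V7) (α β : Form (k + 1)) :
    dCE br (α + β) = dCE br α + dCE br β := by
  funext v
  simp only [dCE, Pi.add_apply, ← Finset.sum_add_distrib]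
  refine Finset.sum_congr rfl fun i _ => Finset.sum_congr rfl fun j _ => ?_
  split_ifs <;> ring

lemma dCE_smul (br : V7 → V7 → V7) (c : ℝ) (α : Form (k + 1)) :
    dCE br (c • α) = c • dCE br α := by
  funext v
  simp only [dCE, Pi.smul_apply, smul_eq_mul, Finset.mul_sum]
  refine Finset.sum_congr rfl fun i _ => Finset.sum_congr rfl fun j _ => ?_
  split_ifs <;> ring

end Linearity

section Differential

variable {k : ℕ}

/-- The shuffle sum `∑_{i<j} (-1)^{i+j} B(xᵢ, xⱼ) β(x₀,…,x̂ᵢ,…,x̂ⱼ,…)`. -/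
def pairSum (B : V7 → V7 → ℝ) (β : Form k) : Form (k + 2) := fun v =>
  ∑ i : Fin (k + 2), ∑ j : Fin (k + 2),
    if (i : ℕ) < (j : ℕ) then
      (-1 : ℝ) ^ ((i : ℕ) + (j : ℕ)) * (B (v i) (v j) *
        β (fun l : Fin k =>
            if (l : ℕ) < (i : ℕ) then v ⟨(l : ℕ), by omega⟩
            else if (l : ℕ) + 1 < (j : ℕ) then v ⟨(l : ℕ) + 1, by omega⟩
            else v ⟨(l : ℕ) + 2, by omega⟩))
    else 0

lemma pairSum_add (B C : V7 → V7 → ℝ) (β : Form k) :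
    pairSum (B + C) β = pairSum B β + pairSum C β := by
  funext v
  simp only [pairSum, Pi.add_apply, ← Finset.sum_add_distrib]
  refine Finset.sum_congr rfl fun i _ => Finset.sum_congr rfl fun j _ => ?_
  split_ifs <;> ring

lemma pairSum_smul (c : ℝ) (B : V7 → V7 → ℝ) (β : Form k) :
    pairSum (c • B) β = c • pairSum B β := by
  funext v
  simp only [pairSum, Pi.smul_apply, smul_eq_mul, Finset.mul_sum]
  refine Finset.sum_congr rfl fun i _ => Finset.sum_congr rfl fun j _ => ?_
  split_ifs <;> ring

lemma eB_cons (I : Fin (k + 1) → Fin 7) (u : V7) (v : Fin k → V7) :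
    eB I (Fin.cons u v) =
      ∑ b : Fin (k + 1), (-1 : ℝ) ^ (b : ℕ) * (u (I b) * eB (fun l => I (b.succAbove l)) v) := by
  rw [eB, Matrix.det_succ_row_zero]
  refine Finset.sum_congr rfl fun b _ => ?_
  rw [mul_assoc]
  rfl

lemma dCE_eB (br : V7 → V7 → V7) (I : Fin (k + 1) → Fin 7) :
    dCE br (eB I) = ∑ b : Fin (k + 1), (-1 : ℝ) ^ (b : ℕ) •
      pairSum (fun x y => br x y (I b)) (eB fun l => I (b.succAbove l)) := by
  funext v
  simp only [dCE, pairSum, eB_cons, Finset.sum_apply, Pi.smul_apply, smul_eq_mul, Finset.mul_sum]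
  rw [Finset.sum_comm]
  conv_rhs => rw [Finset.sum_comm]; enter [2, i]; rw [Finset.sum_comm]
  rw [Finset.sum_comm]
  refine Finset.sum_congr rfl fun i _ => Finset.sum_congr rfl fun j _ => ?_
  split_ifs
  · exact Finset.sum_congr rfl fun _ _ => by ring
  · simp

/-- The bilinear form `e^{pq}`. -/
def elem (p q : Fin 7) : V7 → V7 → ℝ := fun x y => x p * y q - x q * y p

lemma pairSum_elem_one (p q c : Fin 7) : pairSum (elem p q) (eB ![c]) = -eB ![p, q, c] := by
  funext v
  simp [pairSum, elem, eB, Fin.sum_univ_succ, Matrix.det_succ_row_zero, Fin.succAbove]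
  ring

set_option maxHeartbeats 2000000 in
lemma pairSum_elem_three (p q a b c : Fin 7) :
    pairSum (elem p q) (eB ![a, b, c]) = -eB ![p, q, a, b, c] := by
  funext v
  simp [pairSum, elem, eB, Fin.sum_univ_succ, Matrix.det_succ_row_zero, Fin.succAbove]
  ring

end Differential

section Coordinates

variable {k : ℕ}

lemma eB_comp_swap (I : Fin k → Fin 7) {i j : Fin k} (hij : i ≠ j) :
    eB (I ∘ Equiv.swap i j) = -eB I := by
  funext v
  have h := Matrix.det_permute' (Equiv.swap i j) (Matrix.of fun a b : Fin k => v a (I b))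
  rw [Equiv.Perm.sign_swap hij] at h
  exact h.trans (by simp [eB])

lemma eB_eq_zero_of_eq {I : Fin k → Fin 7} {i j : Fin k} (hij : i ≠ j) (h : I i = I j) :
    eB I = 0 := by
  funext v
  exact Matrix.det_zero_of_column_eq hij fun a => by simp [h]

lemma eB_five_swap₀₁ {a b : Fin 7} (c d e : Fin 7) (_ : b < a) :
    eB ![a, b, c, d, e] = -eB ![b, a, c, d, e] := by
  rw [← eB_comp_swap ![b, a, c, d, e] (show (0 : Fin 5) ≠ 1 by decide)]
  congr 1; ext i; fin_cases i <;> rfl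

lemma eB_five_swap₁₂ (a : Fin 7) {b c : Fin 7} (d e : Fin 7) (_ : c < b) :
    eB ![a, b, c, d, e] = -eB ![a, c, b, d, e] := by
  rw [← eB_comp_swap ![a, c, b, d, e] (show (1 : Fin 5) ≠ 2 by decide)]
  congr 1; ext i; fin_cases i <;> rfl

lemma eB_five_swap₂₃ (a b : Fin 7) {c d : Fin 7} (e : Fin 7) (_ : d < c) :
    eB ![a, b, c, d, e] = -eB ![a, b, d, c, e] := by
  rw [← eB_comp_swap ![a, b, d, c, e] (show (2 : Fin 5) ≠ 3 by decide)]
  congr 1; ext i; fin_cases i <;> rfl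

lemma eB_five_swap₃₄ (a b c : Fin 7) {d e : Fin 7} (_ : e < d) :
    eB ![a, b, c, d, e] = -eB ![a, b, c, e, d] := by
  rw [← eB_comp_swap ![a, b, c, e, d] (show (3 : Fin 5) ≠ 4 by decide)]
  congr 1; ext i; fin_cases i <;> rfl

lemma eB_five_eq₀₁ (a c d e : Fin 7) : eB ![a, a, c, d, e] = 0 :=
  eB_eq_zero_of_eq (show (0 : Fin 5) ≠ 1 by decide) rfl

lemma eB_five_eq₁₂ (a b d e : Fin 7) : eB ![a, b, b, d, e] = 0 :=
  eB_eq_zero_of_eq (show (1 : Fin 5) ≠ 2 by decide) rfl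

lemma eB_five_eq₂₃ (a b c e : Fin 7) : eB ![a, b, c, c, e] = 0 :=
  eB_eq_zero_of_eq (show (2 : Fin 5) ≠ 3 by decide) rfl

lemma eB_five_eq₃₄ (a b c d : Fin 7) : eB ![a, b, c, d, d] = 0 :=
  eB_eq_zero_of_eq (show (3 : Fin 5) ≠ 4 by decide) rfl

lemma eB_three_swap₀₁ {a b : Fin 7} (c : Fin 7) (_ : b < a) :
    eB ![a, b, c] = -eB ![b, a, c] := by
  rw [← eB_comp_swap ![b, a, c] (show (0 : Fin 3) ≠ 1 by decide)]
  congr 1; ext i; fin_cases i <;> rfl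

lemma eB_three_swap₁₂ (a : Fin 7) {b c : Fin 7} (_ : c < b) :
    eB ![a, b, c] = -eB ![a, c, b] := by
  rw [← eB_comp_swap ![a, c, b] (show (1 : Fin 3) ≠ 2 by decide)]
  congr 1; ext i; fin_cases i <;> rfl

lemma wedge_eB_two_three (a b c d e : Fin 7) :
    wedge (eB ![a, b]) (eB ![c, d, e]) = eB ![a, b, c, d, e] := by
  rw [wedge_eB_eB]
  congr 1; ext i; fin_cases i <;> rfl

/-- The coordinates of the bracket, `(x, y) ↦ [x, y]_c`. -/
def brCoord (c : Fin 7) : V7 → V7 → ℝ := fun x y => brH x y c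

lemma brCoord_zero : brCoord 0 = (0 : ℝ) • elem 0 0 := by
  funext x y; simp [brCoord, brH]

lemma brCoord_one : brCoord 1 = (0 : ℝ) • elem 0 0 := by
  funext x y; simp [brCoord, brH]

lemma brCoord_two : brCoord 2 = elem 2 6 := by
  funext x y; simp [brCoord, brH, elem]

lemma brCoord_three : brCoord 3 = (-1 : ℝ) • elem 3 6 := by
  funext x y; simp [brCoord, brH, elem]

lemma brCoord_four : brCoord 4 = (-2 : ℝ) • elem 0 3 + (-1 : ℝ) • elem 4 6 := by
  funext x y; simp [brCoord, brH, elem]; ring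

lemma brCoord_five : brCoord 5 = (2 : ℝ) • elem 1 3 + (-1 : ℝ) • elem 5 6 := by
  funext x y; simp [brCoord, brH, elem]; ring

lemma brCoord_six : brCoord 6 = (0 : ℝ) • elem 0 0 := by
  funext x y; simp [brCoord, brH]

lemma dCE_eB_four (a b c d : Fin 7) :
    dCE brH (eB ![a, b, c, d]) =
      pairSum (brCoord a) (eB ![b, c, d]) - pairSum (brCoord b) (eB ![a, c, d])
        + pairSum (brCoord c) (eB ![a, b, d]) - pairSum (brCoord d) (eB ![a, b, c]) := by
  have h₀ : (fun l => ![a, b, c, d] (Fin.succAbove 0 l)) = ![b, c, d] := by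
    ext l; fin_cases l <;> rfl
  have h₁ : (fun l => ![a, b, c, d] (Fin.succAbove 1 l)) = ![a, c, d] := by
    ext l; fin_cases l <;> rfl
  have h₂ : (fun l => ![a, b, c, d] (Fin.succAbove 2 l)) = ![a, b, d] := by
    ext l; fin_cases l <;> rfl
  have h₃ : (fun l => ![a, b, c, d] (Fin.succAbove 3 l)) = ![a, b, c] := by
    ext l; fin_cases l <;> rfl
  rw [dCE_eB, Fin.sum_univ_four, h₀, h₁, h₂, h₃]
  change (-1 : ℝ) ^ 0 • pairSum (brCoord a) _ + (-1 : ℝ) ^ 1 • pairSum (brCoord b) _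
    + (-1 : ℝ) ^ 2 • pairSum (brCoord c) _ + (-1 : ℝ) ^ 3 • pairSum (brCoord d) _ = _
  module

lemma dCE_eB_two (a b : Fin 7) :
    dCE brH (eB ![a, b]) = pairSum (brCoord a) (eB ![b]) - pairSum (brCoord b) (eB ![a]) := by
  have h₀ : (fun l => ![a, b] (Fin.succAbove 0 l)) = ![b] := by
    ext l; fin_cases l; rfl
  have h₁ : (fun l => ![a, b] (Fin.succAbove 1 l)) = ![a] := by
    ext l; fin_cases l; rfl
  rw [dCE_eB, Fin.sum_univ_two, h₀, h₁]
  change (-1 : ℝ) ^ 0 • pairSum (brCoord a) _ + (-1 : ℝ) ^ 1 • pairSum (brCoord b) _ = _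
  module

lemma coe_psiAlt : (psiAlt : Form 4) =
    eB ![2, 3, 4, 5] + eB ![0, 1, 4, 5] + eB ![0, 1, 2, 3] + (-1 : ℝ) • eB ![1, 3, 5, 6]
      + eB ![1, 2, 4, 6] + eB ![0, 3, 4, 6] + eB ![0, 2, 5, 6] := by
  funext v
  simp [psiAlt, sub_eq_add_neg]

lemma phiH_eq : phiH = eB ![0, 1, 6] + eB ![2, 3, 6] + eB ![4, 5, 6] + eB ![0, 2, 4]
    + (-1 : ℝ) • eB ![0, 3, 5] + (-1 : ℝ) • eB ![1, 2, 5] + (-1 : ℝ) • eB ![1, 3, 4] := by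
  funext v
  simp [phiH, sub_eq_add_neg]

lemma tauH_eq :
    tauH = (2 : ℝ) • eB ![0, 1] + (2 : ℝ) • eB ![2, 3] + (-4 : ℝ) • eB ![4, 5] := by
  funext v
  simp [tauH, sub_eq_add_neg]

lemma dCE_psiAlt : dCE brH (psiAlt : Form 4) = wedge tauH phiH := by
  rw [coe_psiAlt, phiH_eq, tauH_eq]
  simp only [dCE_add, dCE_smul, dCE_eB_four, brCoord_zero, brCoord_one, brCoord_two,
    brCoord_three, brCoord_four, brCoord_five, brCoord_six, pairSum_add, pairSum_smul,
    pairSum_elem_three, wedge_add_left, wedge_add_right, wedge_smul_left, wedge_smul_right,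
    wedge_eB_two_three]
  simp (disch := decide) only [eB_five_eq₀₁, eB_five_eq₁₂, eB_five_eq₂₃, eB_five_eq₃₄,
    eB_five_swap₀₁, eB_five_swap₁₂, eB_five_swap₂₃, eB_five_swap₃₄]
  module

lemma dCE_tauH : dCE brH tauH =
    (-8 : ℝ) • (eB ![0, 3, 5] + eB ![1, 3, 4] - eB ![4, 5, 6]) := by
  rw [tauH_eq]
  simp only [dCE_add, dCE_smul, dCE_eB_two, brCoord_zero, brCoord_one, brCoord_two,
    brCoord_three, brCoord_four, brCoord_five, pairSum_add, pairSum_smul, pairSum_elem_one]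
  simp (disch := decide) only [eB_three_swap₀₁, eB_three_swap₁₂]
  module

end Coordinates

/-- if `ψ = *_φφ` (characterized by the pairing property), then
`dψ = τ ∧ φ` with `τ = 2e¹² + 2e³⁴ - 4e⁵⁶`, and `dτ = -8(e¹⁴⁶ + e²⁴⁵ - e⁵⁶⁷)`. -/
theorem torsion_H (ψ : AlternatingMap ℝ V7 ℝ (Fin 4))
    (hψ : ∀ α : AlternatingMap ℝ V7 ℝ (Fin 3), ∀ w : Fin 7 → V7,
      wedge (⇑α) (⇑ψ) w = formInner (fun _ => 1) (⇑α) phiH * vol7 w) :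
    (∀ w, dCE brH (⇑ψ) w = wedge tauH phiH w) ∧
    ∀ w, dCE brH tauH w
      = -8 * (eB ![0, 3, 5] w + eB ![1, 3, 4] w - eB ![4, 5, 6] w) := by
  obtain rfl := eq_psiAlt hψ
  refine ⟨fun w => congrFun dCE_psiAlt w, fun w => ?_⟩
  rw [dCE_tauH]
  rfl

end G2Solitons
end
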